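/- arXiv:2401.06646 — 4 statements merged into one kernel-verified Lean document; each statement's English description precedes it below -/
import Mathlib

section
/- Let E be a finite-dimensional real inner product space, Y ⊆ E a closed convex set, φ : E → ℝ a convex function, and ξ : E → ℝ a convex differentiable function. Define the Bregman divergence B_ξ(u,z) = ξ(u) − ξ(z) − ⟨∇ξ(z), u − z⟩. If z⁺ ∈ Y is a minimizer over Y of the function u ↦ φ(u) + B_ξ(u,z) for some z ∈ E, then for every u ∈ Y one has φ(u) + B_ξ(u,z) ≥ φ(z⁺) + B_ξ(z⁺,z) + B_ξ(u,z⁺). -/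
open Filter Topology in
/-- If `f` grows at rate at least `c` along the segment from `x` to `x + d`, then so does its
linearization at `x`. -/
lemma HasGradientAt.le_inner_of_forall_mul_le_sub
    {E : Type*} [NormedAddCommGroup E] [InnerProductSpace ℝ E] [CompleteSpace E]
    {f : E → ℝ} {g x d : E} {c : ℝ} (hf : HasGradientAt f g x)
    (h : ∀ t : ℝ, 0 < t → t ≤ 1 → t * c ≤ f (x + t • d) - f x) :
    c ≤ inner ℝ g d := by
  have hderiv : HasLineDerivAt ℝ f (inner ℝ g d) x d := by
    simpa using hf.hasFDerivAt.hasLineDerivAt d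
  refine ge_of_tendsto hderiv.tendsto_slope_zero_right ?_
  filter_upwards [Ioc_mem_nhdsGT (zero_lt_one' ℝ)] with t ht
  rw [smul_eq_mul, inv_mul_eq_div, le_div_iff₀' ht.1]
  exact h t ht.1 ht.2

/-- Three-point property for Bregman proximal steps. -/
theorem bregman_three_point_property
    {E : Type*} [NormedAddCommGroup E] [InnerProductSpace ℝ E] [FiniteDimensional ℝ E]
    (Y : Set E) (hYclosed : IsClosed Y) (hYconv : Convex ℝ Y)
    (φ ξ : E → ℝ) (hφ : ConvexOn ℝ Set.univ φ)
    (hξ : ConvexOn ℝ Set.univ ξ) (hξdiff : Differentiable ℝ ξ)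
    (B : E → E → ℝ)
    (hB : ∀ u z, B u z = ξ u - ξ z - inner ℝ (gradient ξ z) (u - z))
    (z zplus : E) (hzplus : zplus ∈ Y)
    (hmin : ∀ u ∈ Y, φ zplus + B zplus z ≤ φ u + B u z) :
    ∀ u ∈ Y, φ zplus + B zplus z + B u zplus ≤ φ u + B u z := by
  intro u hu
  have hlin : inner ℝ (gradient ξ z) (u - zplus) - (φ u - φ zplus)
      ≤ inner ℝ (gradient ξ zplus) (u - zplus) := by
    refine (hξdiff zplus).hasGradientAt.le_inner_of_forall_mul_le_sub fun t ht0 ht1 ↦ ?_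
    have hmem := hYconv.add_smul_sub_mem hzplus hu ⟨ht0.le, ht1⟩
    have hφt : φ (zplus + t • (u - zplus)) ≤ (1 - t) * φ zplus + t * φ u := by
      have hconv := hφ.2 (Set.mem_univ zplus) (Set.mem_univ u) (sub_nonneg.2 ht1) ht0.le
        (sub_add_cancel 1 t)
      rwa [show (1 - t) • zplus + t • u = zplus + t • (u - zplus) by module] at hconv
    have hmin_t := hmin _ hmem
    rw [hB, hB, show zplus + t • (u - zplus) - z = (zplus - z) + t • (u - zplus) by abel,
      inner_add_right, inner_smul_right] at hmin_t
    linarith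
  rw [hB, hB, hB, show u - z = (zplus - z) + (u - zplus) by abel, inner_add_right]
  linarith
end

section
/- Let X ⊆ ℝⁿ be a closed convex set, f : ℝⁿ → ℝ a convex differentiable function, and x̂ ∈ ℝⁿ. Let ξ : ℝⁿ → ℝ be a convex differentiable function satisfying the majorizer conditions: ξ(x) ≥ f(x) for all x ∈ X, ξ(x̂) = f(x̂), and ∇ξ(x̂) = ∇f(x̂). Define the Bregman divergence B_ξ(u,z) = ξ(u) − ξ(z) − ⟨∇ξ(z), u − z⟩. If x⁺ ∈ X is a minimizer of ξ over X, then for every x ∈ X one has f(x⁺) + B_ξ(x, x⁺) ≤ f(x) + B_ξ(x, x̂). -/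
/-- A convex function lies above its first-order approximation at a point of differentiability. -/
theorem ConvexOn.add_inner_gradient_le {E : Type*} [NormedAddCommGroup E] [InnerProductSpace ℝ E]
    [CompleteSpace E] {f : E → ℝ} (hf : ConvexOn ℝ Set.univ f) {z : E}
    (hz : DifferentiableAt ℝ f z) (x : E) :
    f z + inner ℝ (gradient f z) (x - z) ≤ f x := by
  have hconv : ConvexOn ℝ Set.univ (f ∘ AffineMap.lineMap (k := ℝ) z x) := by
    simpa using hf.comp_affineMap (AffineMap.lineMap (k := ℝ) z x)
  have hderiv : HasDerivAt (f ∘ AffineMap.lineMap (k := ℝ) z x)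
      (inner ℝ (gradient f z) (x - z)) 0 := by
    have hfderiv : HasFDerivAt f (InnerProductSpace.toDual ℝ E (gradient f z))
        (AffineMap.lineMap z x (0 : ℝ)) := by
      simpa using hz.hasGradientAt.hasFDerivAt
    simpa using hfderiv.comp_hasDerivAt (0 : ℝ) AffineMap.hasDerivAt_lineMap
  have hslope := hconv.le_slope_of_hasDerivAt (Set.mem_univ 0) (Set.mem_univ 1) one_pos hderiv
  simp only [slope_def_field, Function.comp_apply, AffineMap.lineMap_apply_zero,
    AffineMap.lineMap_apply_one, sub_zero, div_one] at hslope
  linarith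

/-- First-order optimality condition for a minimizer over a convex set. -/
theorem IsMinOn.inner_gradient_nonneg {E : Type*} [NormedAddCommGroup E] [InnerProductSpace ℝ E]
    [CompleteSpace E] {f : E → ℝ} {s : Set E} {z : E} (hmin : IsMinOn f s z)
    (hs : Convex ℝ s) (hzs : z ∈ s) (hz : DifferentiableAt ℝ f z) {x : E} (hx : x ∈ s) :
    0 ≤ inner ℝ (gradient f z) (x - z) := by
  simpa using hmin.localize.hasFDerivWithinAt_nonneg
    hz.hasGradientAt.hasFDerivAt.hasFDerivWithinAt
    (sub_mem_posTangentConeAt_of_segment_subset (hs.segment_subset hzs hx))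

/-- One-step inequality of BMMe: an MM step at an extrapolated point viewed as a
mirror descent step with an adaptively chosen Bregman divergence. -/
theorem mm_step_mirror_descent_inequality
    {n : ℕ} (X : Set (EuclideanSpace ℝ (Fin n))) (hXclosed : IsClosed X) (hXconv : Convex ℝ X)
    (f ξ : EuclideanSpace ℝ (Fin n) → ℝ)
    (hf : ConvexOn ℝ Set.univ f) (hfdiff : Differentiable ℝ f)
    (hξ : ConvexOn ℝ Set.univ ξ) (hξdiff : Differentiable ℝ ξ)
    (xhat : EuclideanSpace ℝ (Fin n))
    (hmaj : ∀ x ∈ X, f x ≤ ξ x)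
    (heq : ξ xhat = f xhat)
    (hgrad : gradient ξ xhat = gradient f xhat)
    (B : EuclideanSpace ℝ (Fin n) → EuclideanSpace ℝ (Fin n) → ℝ)
    (hB : ∀ u z, B u z = ξ u - ξ z - inner ℝ (gradient ξ z) (u - z))
    (xplus : EuclideanSpace ℝ (Fin n)) (hxplus : xplus ∈ X)
    (hmin : ∀ x ∈ X, ξ xplus ≤ ξ x) :
    ∀ x ∈ X, f xplus + B x xplus ≤ f x + B x xhat := by
  intro x hx
  have hopt : 0 ≤ inner ℝ (gradient ξ xplus) (x - xplus) :=
    IsMinOn.inner_gradient_nonneg hmin hXconv hxplus (hξdiff xplus) hx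
  have hlower := hf.add_inner_gradient_le (hfdiff xhat) x
  rw [hB, hB, hgrad, heq]
  linarith [hmaj xplus hxplus]
end

section
/- Let δ > 0 and let W, W̃ be m×r real matrices. Set A = W̃ᵀW̃ + δI (an r×r symmetric positive definite matrix) and φ(W) = log det(WᵀW + δI). Then φ(W) ≤ φ(W̃) + ⟨2·W̃·A⁻¹, W − W̃⟩_F + ‖A⁻¹‖₂·‖W − W̃‖_F², where ⟨·,·⟩_F is the Frobenius (trace) inner product on m×r matrices, ‖·‖_F the Frobenius norm, and ‖·‖₂ the spectral (ℓ₂ operator) norm. Moreover ‖A⁻¹‖₂ ≤ 1/δ, so the curvature constant L_{φ}(W̃) = 2‖A⁻¹‖₂ is bounded above by 2/δ. -/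
open Matrix in
/-- The concavity bound `log det M ≤ tr (M - I)` for positive definite `M`. -/
theorem Matrix.PosDef.log_det_le_trace_sub_card {n : Type*} [Fintype n] [DecidableEq n]
    {M : Matrix n n ℝ} (hM : M.PosDef) :
    Real.log M.det ≤ M.trace - Fintype.card n := by
  have hdet : M.det = ∏ i, hM.isHermitian.eigenvalues i := by
    simpa using hM.isHermitian.det_eq_prod_eigenvalues
  have htr : M.trace = ∑ i, hM.isHermitian.eigenvalues i := by
    simpa using hM.isHermitian.trace_eq_sum_eigenvalues
  rw [hdet, htr, Real.log_prod fun i _ => (hM.eigenvalues_pos i).ne']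
  calc ∑ i, Real.log (hM.isHermitian.eigenvalues i)
      ≤ ∑ i, (hM.isHermitian.eigenvalues i - 1) :=
        Finset.sum_le_sum fun i _ => Real.log_le_sub_one_of_pos (hM.eigenvalues_pos i)
    _ = _ := by simp [Finset.sum_sub_distrib]

open Matrix in
open scoped MatrixOrder Matrix.Norms.L2Operator in
/-- The tangent-plane bound for the concave function `log det` on positive definite matrices. -/
theorem Matrix.PosDef.log_det_le_log_det_add_trace {n : Type*} [Fintype n] [DecidableEq n]
    {A B : Matrix n n ℝ} (hA : A.PosDef) (hB : B.PosDef) :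
    Real.log B.det ≤ Real.log A.det + (A⁻¹ * (B - A)).trace := by
  obtain ⟨C, hC⟩ : ∃ C : Matrix n n ℝ, A⁻¹ = Cᴴ * C :=
    CStarAlgebra.nonneg_iff_eq_star_mul_self.mp hA.inv.posSemidef.nonneg
  have hCdet : C.det * C.det = A.det⁻¹ := by
    have := congrArg det hC
    simpa [det_nonsing_inv] using this.symm
  have hCunit : IsUnit C := by
    rw [isUnit_iff_isUnit_det, isUnit_iff_ne_zero]
    intro h
    rw [h, zero_mul] at hCdet
    exact (inv_pos.mpr hA.det_pos).ne hCdet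
  have hM : (C * B * Cᴴ).PosDef :=
    hB.mul_mul_conjTranspose_same (vecMul_injective_of_isUnit hCunit)
  have hdet : (C * B * Cᴴ).det = A.det⁻¹ * B.det := by
    rw [← hCdet]
    simp
    ring
  have htr : (C * B * Cᴴ).trace = (A⁻¹ * B).trace := by
    rw [hC, trace_mul_comm, ← Matrix.mul_assoc]
  have hlog := hM.log_det_le_trace_sub_card
  rw [hdet, htr, Real.log_mul (inv_pos.mpr hA.det_pos).ne' hB.det_pos.ne', Real.log_inv] at hlog
  rw [Matrix.mul_sub, nonsing_inv_mul _ hA.det_pos.ne'.isUnit, trace_sub, trace_one]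
  linarith

open Matrix in
open scoped Matrix.Norms.L2Operator in
/-- A quadratic form is bounded by the spectral norm of its matrix. -/
theorem Matrix.dotProduct_mulVec_le_l2_opNorm {n : Type*} [Fintype n] [DecidableEq n]
    (A : Matrix n n ℝ) (x : n → ℝ) :
    x ⬝ᵥ A *ᵥ x ≤ ‖A‖ * ∑ i, x i ^ 2 := by
  have h := real_inner_le_norm (WithLp.toLp 2 x) (WithLp.toLp 2 (A *ᵥ x))
  have hop := l2_opNorm_mulVec A (WithLp.toLp 2 x)
  have hsq : ‖WithLp.toLp 2 x‖ ^ 2 = ∑ i, x i ^ 2 := by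
    simp [EuclideanSpace.norm_sq_eq]
  rw [EuclideanSpace.inner_toLp_toLp, star_trivial, dotProduct_comm] at h
  calc x ⬝ᵥ A *ᵥ x ≤ ‖WithLp.toLp 2 x‖ * ‖WithLp.toLp 2 (A *ᵥ x)‖ := h
    _ ≤ ‖WithLp.toLp 2 x‖ * (‖A‖ * ‖WithLp.toLp 2 x‖) := by gcongr; exact hop
    _ = ‖A‖ * ∑ i, x i ^ 2 := by rw [← hsq]; ring

open Matrix in
open scoped Matrix.Norms.L2Operator in
theorem Matrix.trace_mul_mul_transpose_le_l2_opNorm {m n : Type*} [Fintype m] [Fintype n]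
    [DecidableEq n] (A : Matrix n n ℝ) (D : Matrix m n ℝ) :
    (D * A * Dᵀ).trace ≤ ‖A‖ * ∑ i, ∑ j, D i j ^ 2 := by
  rw [Finset.mul_sum, trace]
  refine Finset.sum_le_sum fun i _ => ?_
  have h := dotProduct_mulVec_le_l2_opNorm A (D i)
  rwa [dotProduct_mulVec] at h

open Matrix in
open scoped Matrix.Norms.L2Operator in
/-- A matrix whose quadratic form dominates `δ‖x‖²` has an inverse of spectral norm at most
`1 / δ`. -/
theorem Matrix.l2_opNorm_inv_le {n : Type*} [Fintype n] [DecidableEq n]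
    {A : Matrix n n ℝ} {δ : ℝ} (hδ : 0 < δ) (hA : IsUnit A.det)
    (hform : ∀ x : n → ℝ, δ * (x ⬝ᵥ x) ≤ x ⬝ᵥ A *ᵥ x) :
    ‖A⁻¹‖ ≤ 1 / δ := by
  rw [← l2_opNorm_toEuclideanCLM]
  refine ContinuousLinearMap.opNorm_le_bound _ (by positivity) fun x => ?_
  set y := toEuclideanCLM (n := n) (𝕜 := ℝ) A⁻¹ x with hy
  have hAy : A *ᵥ y.ofLp = x.ofLp := by
    rw [hy, ofLp_toEuclideanCLM, mulVec_mulVec, mul_nonsing_inv _ hA, one_mulVec]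
  have h := hform y.ofLp
  have hxy := real_inner_le_norm x y
  have hyy : ‖y‖ ^ 2 = y.ofLp ⬝ᵥ y.ofLp := by
    simp [EuclideanSpace.real_norm_sq_eq, dotProduct, ← sq]
  rw [hAy, ← hyy] at h
  rw [EuclideanSpace.inner_eq_star_dotProduct, star_trivial] at hxy
  rw [one_div, inv_mul_eq_div, le_div_iff₀ hδ]
  rcases (norm_nonneg y).eq_or_lt with h0 | hpos
  · rw [← h0, zero_mul]
    exact norm_nonneg x
  · exact le_of_mul_le_mul_right (by linarith) hpos

open Matrix in
theorem Matrix.posDef_transpose_mul_self_add_smul_one {m n : Type*} [Fintype m] [Fintype n]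
    [DecidableEq n] {δ : ℝ} (hδ : 0 < δ) (V : Matrix m n ℝ) :
    (Vᵀ * V + δ • (1 : Matrix n n ℝ)).PosDef :=
  PosDef.posSemidef_add (by simpa using posSemidef_conjTranspose_mul_self V) (PosDef.one.smul hδ)

open Matrix Finset in
open scoped Matrix.Norms.L2Operator in
/-- Quadratic upper bound for the minimum-volume regularizer
`φ(W) = log det (WᵀW + δI)` around `W̃` (Lemma 4.2 of the paper). The inner
product is the Frobenius one, written via the trace, the last sum is the squared
Frobenius norm of `W - W̃`, and `‖·‖` is the spectral (ℓ₂ operator) norm. -/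
theorem logdet_minvol_quadratic_upper_bound
    {m r : ℕ} (δ : ℝ) (hδ : 0 < δ)
    (W Wtilde : Matrix (Fin m) (Fin r) ℝ)
    (A : Matrix (Fin r) (Fin r) ℝ)
    (hA : A = Wtildeᵀ * Wtilde + δ • (1 : Matrix (Fin r) (Fin r) ℝ))
    (φ : Matrix (Fin m) (Fin r) ℝ → ℝ)
    (hφ : ∀ V, φ V = Real.log (Vᵀ * V + δ • (1 : Matrix (Fin r) (Fin r) ℝ)).det) :
    φ W ≤ φ Wtilde + (((2 : ℝ) • (Wtilde * A⁻¹))ᵀ * (W - Wtilde)).trace +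
        ‖A⁻¹‖ * ∑ i, ∑ j, (W i j - Wtilde i j) ^ 2 ∧
      ‖A⁻¹‖ ≤ 1 / δ ∧ 2 * ‖A⁻¹‖ ≤ 2 / δ := by
  have hApos : A.PosDef := hA ▸ posDef_transpose_mul_self_add_smul_one hδ Wtilde
  have hnorm : ‖A⁻¹‖ ≤ 1 / δ := by
    refine l2_opNorm_inv_le hδ hApos.det_pos.ne'.isUnit fun x => ?_
    rw [hA, add_mulVec, dotProduct_add, smul_mulVec, one_mulVec, dotProduct_smul, smul_eq_mul,
      ← mulVec_mulVec, dotProduct_mulVec, vecMul_transpose]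
    exact le_add_of_nonneg_left (Finset.sum_nonneg fun i _ => mul_self_nonneg _)
  refine ⟨?_, hnorm, ?_⟩
  · have htangent := hApos.log_det_le_log_det_add_trace
      (posDef_transpose_mul_self_add_smul_one hδ W)
    have hquad := trace_mul_mul_transpose_le_l2_opNorm A⁻¹ (W - Wtilde)
    have hinv : (A⁻¹)ᵀ = A⁻¹ := by simpa using hApos.inv.isHermitian.eq
    set D := W - Wtilde with hD
    have hdiff : Wᵀ * W + δ • (1 : Matrix (Fin r) (Fin r) ℝ) - A =
        Wtildeᵀ * D + Dᵀ * Wtilde + Dᵀ * D := by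
      rw [hA, hD, transpose_sub]
      simp only [Matrix.mul_sub, Matrix.sub_mul]
      abel
    have hcross : (A⁻¹ * (Dᵀ * Wtilde)).trace = (A⁻¹ * (Wtildeᵀ * D)).trace := by
      rw [← trace_transpose, transpose_mul, transpose_mul, transpose_transpose, hinv,
        trace_mul_comm]
    have hsquare : (A⁻¹ * (Dᵀ * D)).trace = (D * A⁻¹ * Dᵀ).trace := by
      rw [← Matrix.mul_assoc, trace_mul_comm, Matrix.mul_assoc]
    have hlin : (((2 : ℝ) • (Wtilde * A⁻¹))ᵀ * D).trace = 2 * (A⁻¹ * (Wtildeᵀ * D)).trace := by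
      rw [transpose_smul, transpose_mul, hinv, smul_mul, trace_smul, smul_eq_mul,
        Matrix.mul_assoc]
    rw [hdiff, Matrix.mul_add, Matrix.mul_add, trace_add, trace_add, hcross, hsquare] at htangent
    rw [hφ, hφ, ← hA, hlin]
    simp only [hD, Matrix.sub_apply] at hquad htangent ⊢
    linarith
  · calc 2 * ‖A⁻¹‖ ≤ 2 * (1 / δ) := by gcongr
      _ = 2 / δ := by ring
end

section
/- Let M be an r×r real symmetric positive semidefinite matrix and let W, W̃ be m×r real matrices. Then trace(M·WᵀW) − trace(M·W̃ᵀW̃) ≤ 2·trace(M·W̃ᵀ(W − W̃)) + ‖M‖₂·‖W − W̃‖_F², where ‖M‖₂ is the spectral (ℓ₂ operator) norm and ‖·‖_F the Frobenius norm. -/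
open scoped Matrix.Norms.L2Operator in
theorem Matrix.dotProduct_mulVec_self_le_l2_opNorm {n : Type*} [Fintype n] [DecidableEq n]
    (M : Matrix n n ℝ) (v : n → ℝ) :
    v ⬝ᵥ M.mulVec v ≤ ‖M‖ * ∑ j, v j ^ 2 := by
  set x : EuclideanSpace ℝ n := WithLp.toLp 2 v
  have hx : ∑ j, v j ^ 2 = ‖x‖ * ‖x‖ := by
    rw [← sq, EuclideanSpace.real_norm_sq_eq]
  calc v ⬝ᵥ M.mulVec v = inner ℝ x (Matrix.toEuclideanCLM (n := n) (𝕜 := ℝ) M x) :=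
        (Matrix.inner_toEuclideanCLM M x x).symm
    _ ≤ ‖x‖ * ‖Matrix.toEuclideanCLM (n := n) (𝕜 := ℝ) M x‖ := real_inner_le_norm _ _
    _ ≤ ‖x‖ * (‖M‖ * ‖x‖) := by
        gcongr
        exact ContinuousLinearMap.le_opNorm _ _
    _ = ‖M‖ * ∑ j, v j ^ 2 := by rw [hx]; ring

open scoped Matrix.Norms.L2Operator in
theorem Matrix.trace_mul_gram_le_l2_opNorm {m n : Type*} [Fintype m] [Fintype n] [DecidableEq n]
    (M : Matrix n n ℝ) (A : Matrix m n ℝ) :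
    (M * (A.transpose * A)).trace ≤ ‖M‖ * ∑ i, ∑ j, A i j ^ 2 := by
  have h : (M * (A.transpose * A)).trace = ∑ i, A i ⬝ᵥ M.mulVec (A i) := by
    rw [← Matrix.mul_assoc, Matrix.trace_mul_comm]
    rfl
  rw [h, Finset.mul_sum]
  exact Finset.sum_le_sum fun i _ => M.dotProduct_mulVec_self_le_l2_opNorm (A i)

theorem Matrix.IsSymm.trace_mul_transpose_mul_comm {m n R : Type*} [Fintype m] [Fintype n]
    [CommSemiring R] {M : Matrix n n R} (hM : M.IsSymm) (A B : Matrix m n R) :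
    (M * (A.transpose * B)).trace = (M * (B.transpose * A)).trace := by
  rw [← Matrix.trace_transpose, Matrix.transpose_mul, Matrix.transpose_mul,
    Matrix.transpose_transpose, hM.eq, Matrix.trace_mul_comm]

open Matrix Finset in
open scoped Matrix.Norms.L2Operator in
/-- Smoothness inequality for the quadratic matrix function `W ↦ trace (M * WᵀW)`:
here `‖M‖` is the spectral (ℓ₂ operator) norm and the last sum is the squared
Frobenius norm of `W - W̃`. -/
theorem trace_gram_smoothness_inequality
    {m r : ℕ} (M : Matrix (Fin r) (Fin r) ℝ) (hM : M.PosSemidef)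
    (W Wtilde : Matrix (Fin m) (Fin r) ℝ) :
    (M * (Wᵀ * W)).trace - (M * (Wtildeᵀ * Wtilde)).trace ≤
      2 * (M * (Wtildeᵀ * (W - Wtilde))).trace +
        ‖M‖ * ∑ i, ∑ j, (W i j - Wtilde i j) ^ 2 := by
  have hsymm : M.IsSymm := by simpa [Matrix.IsSymm] using hM.isHermitian.eq
  have hcross := hsymm.trace_mul_transpose_mul_comm W Wtilde
  have hbound := M.trace_mul_gram_le_l2_opNorm (W - Wtilde)
  simp only [Matrix.transpose_sub, Matrix.sub_mul, Matrix.mul_sub, Matrix.trace_sub,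
    Matrix.sub_apply] at hbound ⊢
  linarith
end
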